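/- Let $\varphi(\tau, z)$ be a Jacobi-like form of weight $w$ and index $m$ (transforming as $\varphi(\tfrac{a\tau+b}{c\tau+d}, \tfrac{z}{c\tau+d}) = (c\tau+d)^w e^{\frac{2\pi i m c z^2}{c\tau+d}}\varphi(\tau,z)$) that is smooth in $z$ near $z=0$. Define the differential operator $\mathcal{D}_m^{(n)} = \sum_{k=0}^{\lfloor n/2\rfloor} \frac{n! (\frac{2m}{3}\pi^2)^k}{(2k)!! (n-2k)!} E_2(\tau)^k \partial_z^{n-2k}$. Then $\phi^{(n)}(\tau) = (\mathcal{D}_m^{(n)}\varphi)(\tau, 0)$ transforms as a modular form of weight $w + n$: $\phi^{(n)}(\tfrac{a\tau+b}{c\tau+d}) = (c\tau+d)^{w+n}\phi^{(n)}(\tau)$. -/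

import Mathlib

open Complex

/-- The quasimodular Eisenstein series `E₂(τ) = 1 - 24 ∑_{n≥1} σ₁(n) e^{2πinτ}`. -/
noncomputable def E2 (τ : ℂ) : ℂ :=
  1 - 24 * ∑' n : ℕ, (∑ d ∈ Nat.divisors (n + 1), (d : ℂ)) *
    Complex.exp (2 * (Real.pi : ℂ) * I * ((n : ℂ) + 1) * τ)

open UpperHalfPlane in
/-- An integral matrix of determinant one, as an element of `SL(2, ℤ)`, has the expected
automorphy factor and acts on the upper half-plane in the expected way. -/
theorem exists_sl_denom_smul {a b c d : ℤ} (h : a * d - b * c = 1) (z : ℍ) :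
    ∃ γ : Matrix.SpecialLinearGroup (Fin 2) ℤ, γ 1 0 = c ∧ denom γ z = (c : ℂ) * z + d ∧
      ((γ • z : ℍ) : ℂ) = (a * z + b) / (c * z + d) := by
  let γ : Matrix.SpecialLinearGroup (Fin 2) ℤ :=
    ⟨!![a, b; c, d], by rw [Matrix.det_fin_two_of, h]⟩
  have h00 : γ 0 0 = a := rfl
  have h01 : γ 0 1 = b := rfl
  have h10 : γ 1 0 = c := rfl
  have h11 : γ 1 1 = d := rfl
  refine ⟨γ, h10, ?_, ?_⟩
  · rw [ModularGroup.denom_apply, h10, h11]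
  · rw [coe_specialLinearGroup_apply, h00, h01, h10, h11]
    simp

theorem moebius_denom_ne_zero {a b c d : ℤ} (h : a * d - b * c = 1) {τ : ℂ} (hτ : 0 < τ.im) :
    (c : ℂ) * τ + d ≠ 0 := by
  obtain ⟨γ, -, hden, -⟩ := exists_sl_denom_smul h ⟨τ, hτ⟩
  exact hden ▸ UpperHalfPlane.denom_ne_zero γ _

theorem im_moebius_pos {a b c d : ℤ} (h : a * d - b * c = 1) {τ : ℂ} (hτ : 0 < τ.im) :
    0 < (((a : ℂ) * τ + b) / (c * τ + d)).im := by
  obtain ⟨γ, -, -, hsmul⟩ := exists_sl_denom_smul h ⟨τ, hτ⟩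
  exact hsmul ▸ (γ • (⟨τ, hτ⟩ : UpperHalfPlane)).im_pos

open UpperHalfPlane in
/-- On the upper half-plane, the `q`-series `E2` is Mathlib's normalised Eisenstein series. -/
theorem E2_coe (z : ℍ) : E2 z = EisensteinSeries.E2 z := by
  rw [EisensteinSeries.E2_eq_tsum_cexp,
    tsum_pnat_eq_tsum_succ (f := fun n ↦ (ArithmeticFunction.sigma 1 n : ℂ) *
      Complex.exp (2 * Real.pi * Complex.I * z) ^ n), E2]
  congr 2
  refine tsum_congr fun n ↦ ?_
  rw [ArithmeticFunction.sigma_one_apply, ← Complex.exp_nat_mul]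
  push_cast
  congr 2
  ring

open UpperHalfPlane in
/-- The quasimodular transformation law of `E2`. -/
theorem E2_moebius {a b c d : ℤ} (h : a * d - b * c = 1) {τ : ℂ} (hτ : 0 < τ.im) :
    E2 ((a * τ + b) / (c * τ + d)) =
      (c * τ + d) ^ 2 * E2 τ + 6 / (Real.pi * Complex.I) * c * (c * τ + d) := by
  have hne := moebius_denom_ne_zero h hτ
  lift τ to ℍ using hτ with z
  obtain ⟨γ, hc, hden, hsmul⟩ := exists_sl_denom_smul h z
  have hslash := congrFun (EisensteinSeries.E2_slash_action γ) z
  rw [ModularForm.SL_slash_apply] at hslash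
  simp only [Pi.sub_apply, Pi.smul_apply, smul_eq_mul, EisensteinSeries.D2, riemannZeta_two,
    ← E2_coe, hsmul, hden, hc] at hslash
  rw [zpow_neg, ← div_eq_mul_inv,
    div_eq_iff (zpow_ne_zero _ hne)] at hslash
  rw [hslash]
  have hpi : (Real.pi : ℂ) ≠ 0 := by exact_mod_cast Real.pi_ne_zero
  field_simp
  linear_combination (-6 * (c : ℂ)) * Complex.I_sq

/-- No regularity of `f` is needed to differentiate along a dilation. -/
theorem iteratedDeriv_comp_dilation (f : ℂ → ℂ) (c : ℂ) (n : ℕ) :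
    iteratedDeriv n (fun z ↦ f (c * z)) = fun z ↦ c ^ n * iteratedDeriv n f (c * z) := by
  induction n with
  | zero => simp
  | succ n ih =>
    funext z
    rw [iteratedDeriv_succ, ih, deriv_const_mul_field, deriv_comp_mul_left c,
      ← iteratedDeriv_succ, smul_eq_mul]
    ring

section Gaussian

theorem contDiff_cexp_mul_sq (α : ℂ) {n : WithTop ℕ∞} :
    ContDiff ℂ n (fun z : ℂ ↦ Complex.exp (α * z ^ 2)) := by
  fun_prop

theorem deriv_cexp_mul_sq (α : ℂ) :
    deriv (fun z : ℂ ↦ Complex.exp (α * z ^ 2)) =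
      fun z ↦ 2 * α * (z * Complex.exp (α * z ^ 2)) := by
  funext z
  have h := (((hasDerivAt_id z).pow 2).const_mul α).cexp
  convert! h.deriv using 1
  simp
  ring

theorem iteratedDeriv_add_two_cexp_mul_sq (α : ℂ) (n : ℕ) :
    iteratedDeriv (n + 2) (fun z : ℂ ↦ Complex.exp (α * z ^ 2)) = fun z ↦
      2 * α * (z * iteratedDeriv (n + 1) (fun z : ℂ ↦ Complex.exp (α * z ^ 2)) z +
        (n + 1) * iteratedDeriv n (fun z : ℂ ↦ Complex.exp (α * z ^ 2)) z) := by
  have hd (k : ℕ) (z : ℂ) :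
      HasDerivAt (iteratedDeriv k (fun z : ℂ ↦ Complex.exp (α * z ^ 2)))
        (iteratedDeriv (k + 1) (fun z : ℂ ↦ Complex.exp (α * z ^ 2)) z) z := by
    rw [iteratedDeriv_succ]
    exact ((contDiff_cexp_mul_sq α (n := ((k + 1 : ℕ) : WithTop ℕ∞))).differentiable_iteratedDeriv k
      (by exact_mod_cast Nat.lt_succ_self k) z).hasDerivAt
  induction n with
  | zero =>
    funext z
    have h := ((hasDerivAt_id z).mul (hd 0 z)).const_mul (2 * α)
    rw [iteratedDeriv_zero] at h
    refine Eq.trans ?_ (h.deriv.trans ?_)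
    · rw [iteratedDeriv_succ, iteratedDeriv_one, deriv_cexp_mul_sq]
      rfl
    · rw [id_eq, iteratedDeriv_zero]
      push_cast
      ring
  | succ n ih =>
    funext z
    have h := (((hasDerivAt_id z).mul (hd (n + 1) z)).add
      ((hd n z).const_mul ((n : ℂ) + 1))).const_mul (2 * α)
    refine Eq.trans ?_ (h.deriv.trans ?_)
    · rw [show n + 1 + 2 = (n + 2) + 1 by ring, iteratedDeriv_succ, ih]
      rfl
    · rw [id_eq]
      push_cast
      ring

theorem iteratedDeriv_odd_cexp_mul_sq_zero (α : ℂ) (k : ℕ) :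
    iteratedDeriv (2 * k + 1) (fun z : ℂ ↦ Complex.exp (α * z ^ 2)) 0 = 0 := by
  induction k with
  | zero => simp [iteratedDeriv_one, deriv_cexp_mul_sq]
  | succ k ih =>
    rw [show 2 * (k + 1) + 1 = (2 * k + 1) + 2 by ring, iteratedDeriv_add_two_cexp_mul_sq]
    simp [ih]

theorem iteratedDeriv_even_cexp_mul_sq_zero (α : ℂ) (k : ℕ) :
    iteratedDeriv (2 * k) (fun z : ℂ ↦ Complex.exp (α * z ^ 2)) 0 =
      (2 * k).factorial * (2 * α) ^ k / (2 * k).doubleFactorial := by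
  induction k with
  | zero => simp
  | succ k ih =>
    have hne : ((2 * k).doubleFactorial : ℂ) ≠ 0 := by
      exact_mod_cast (Nat.doubleFactorial_pos _).ne'
    have hk : (2 * (k : ℂ) + 2) ≠ 0 := by exact_mod_cast Nat.succ_ne_zero (2 * k + 1)
    rw [show 2 * (k + 1) = 2 * k + 2 by ring, iteratedDeriv_add_two_cexp_mul_sq,
      Nat.doubleFactorial_add_two, Nat.factorial_succ, Nat.factorial_succ]
    simp only [ih]
    push_cast
    field_simp
    ring

end Gaussian

theorem sum_range_succ_eq_sum_even {M : Type*} [AddCommMonoid M] (n : ℕ) (h : ℕ → M)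
    (hodd : ∀ k, h (2 * k + 1) = 0) :
    ∑ i ∈ Finset.range (n + 1), h i = ∑ k ∈ Finset.range (n / 2 + 1), h (2 * k) := by
  symm
  refine Finset.sum_of_injOn (2 * ·) (fun x _ y _ hxy ↦ by simpa using hxy) ?_ ?_ (by simp)
  · intro k hk
    simp only [Finset.coe_range, Set.mem_Iio] at hk ⊢
    lia
  · intro i hi hne
    rcases Nat.even_or_odd' i with ⟨k, rfl | rfl⟩
    · refine absurd ⟨k, ?_, rfl⟩ hne
      simp only [Finset.coe_range, Set.mem_Iio, Finset.mem_range] at hi ⊢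
      lia
    · exact hodd k

/-- The modular differential operator computes the Taylor coefficients of the product of `f` with
a Gaussian. -/
theorem sum_doubleFactorial_iteratedDeriv_eq {f : ℂ → ℂ} (hf : AnalyticAt ℂ f 0) (A E : ℂ)
    (n : ℕ) :
    (∑ k ∈ Finset.range (n / 2 + 1),
      ((n.factorial : ℂ) * A ^ k /
        ((Nat.doubleFactorial (2 * k) : ℂ) * ((n - 2 * k).factorial : ℂ))) *
        E ^ k * iteratedDeriv (n - 2 * k) f 0) =
      iteratedDeriv n (fun z ↦ Complex.exp (A * E / 2 * z ^ 2) * f z) 0 := by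
  rw [iteratedDeriv_fun_mul (contDiff_cexp_mul_sq _).contDiffAt hf.contDiffAt,
    sum_range_succ_eq_sum_even n (fun i ↦ (n.choose i : ℂ) * iteratedDeriv i _ 0 * _)
      fun k ↦ by simp [iteratedDeriv_odd_cexp_mul_sq_zero]]
  refine Finset.sum_congr rfl fun k hk ↦ ?_
  have hkn : 2 * k ≤ n := by
    rw [Finset.mem_range] at hk
    lia
  rw [iteratedDeriv_even_cexp_mul_sq_zero, Nat.cast_choose ℂ hkn,
    show 2 * (A * E / 2) = A * E by ring, mul_pow]
  have h1 : ((2 * k).factorial : ℂ) ≠ 0 := by exact_mod_cast Nat.factorial_ne_zero _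
  have h2 : ((n - 2 * k).factorial : ℂ) ≠ 0 := by exact_mod_cast Nat.factorial_ne_zero _
  have h3 : ((2 * k).doubleFactorial : ℂ) ≠ 0 := by
    exact_mod_cast (Nat.doubleFactorial_pos _).ne'
  field_simp

/-- Applying the modular differential operator
`𝒟ₘ⁽ⁿ⁾ = ∑_{k≤⌊n/2⌋} (n! ((2m/3)π²)^k / ((2k)!! (n-2k)!)) E₂(τ)^k ∂_z^{n-2k}`
to a Jacobi-like form `φ` of weight `w` and index `m` and evaluating at `z = 0`
yields a modular form of weight `w + n`. -/
theorem modular_operator_weight (w : ℤ) (m : ℂ) (n : ℕ) (φ : ℂ → ℂ → ℂ)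
    (hφ : ∀ a b c d : ℤ, a * d - b * c = 1 → ∀ τ z : ℂ, 0 < τ.im →
      φ (((a : ℂ) * τ + b) / ((c : ℂ) * τ + d)) (z / ((c : ℂ) * τ + d))
        = ((c : ℂ) * τ + d) ^ w *
            Complex.exp (2 * (Real.pi : ℂ) * I * m * (c : ℂ) * z ^ 2 / ((c : ℂ) * τ + d)) *
            φ τ z)
    (hsmooth : ∀ τ : ℂ, 0 < τ.im → AnalyticAt ℂ (fun z => φ τ z) 0) :
    ∀ a b c d : ℤ, a * d - b * c = 1 → ∀ τ : ℂ, 0 < τ.im →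
      (∑ k ∈ Finset.range (n / 2 + 1),
          ((n.factorial : ℂ) * ((2 * m / 3) * (Real.pi : ℂ) ^ 2) ^ k /
              ((Nat.doubleFactorial (2 * k) : ℂ) * ((n - 2 * k).factorial : ℂ))) *
            E2 (((a : ℂ) * τ + b) / ((c : ℂ) * τ + d)) ^ k *
            iteratedDeriv (n - 2 * k) (fun z => φ (((a : ℂ) * τ + b) / ((c : ℂ) * τ + d)) z) 0)
      = ((c : ℂ) * τ + d) ^ (w + (n : ℤ)) *
          (∑ k ∈ Finset.range (n / 2 + 1),
            ((n.factorial : ℂ) * ((2 * m / 3) * (Real.pi : ℂ) ^ 2) ^ k /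
                ((Nat.doubleFactorial (2 * k) : ℂ) * ((n - 2 * k).factorial : ℂ))) *
              E2 τ ^ k * iteratedDeriv (n - 2 * k) (fun z => φ τ z) 0) := by
  intro a b c d h τ hτ
  have hτ' := im_moebius_pos h hτ
  have hj := moebius_denom_ne_zero h hτ
  rw [sum_doubleFactorial_iteratedDeriv_eq (hsmooth _ hτ'),
    sum_doubleFactorial_iteratedDeriv_eq (hsmooth _ hτ), E2_moebius h hτ]
  set j : ℂ := (c : ℂ) * τ + d with hjdef
  have hpi : (Real.pi : ℂ) ≠ 0 := by exact_mod_cast Real.pi_ne_zero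
  have key : (fun z ↦ Complex.exp (2 * m / 3 * (Real.pi : ℂ) ^ 2 *
        (j ^ 2 * E2 τ + 6 / (Real.pi * I) * c * j) / 2 * z ^ 2) * φ ((a * τ + b) / j) z) =
      fun z ↦ j ^ w * (Complex.exp (2 * m / 3 * (Real.pi : ℂ) ^ 2 * E2 τ / 2 * (j * z) ^ 2) *
        φ τ (j * z)) := by
    funext z
    have ht := hφ a b c d h τ (j * z) hτ
    rw [← hjdef, mul_div_cancel_left₀ _ hj] at ht
    rw [ht, ← mul_assoc, mul_left_comm, ← Complex.exp_add, mul_assoc]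
    congr 3
    field_simp
    linear_combination 6 * m * z ^ 2 * c * I_sq
  rw [key, iteratedDeriv_const_mul_field,
    iteratedDeriv_comp_dilation (fun u ↦ Complex.exp (_ * u ^ 2) * φ τ u)]
  simp only [mul_zero]
  rw [zpow_add₀ hj, zpow_natCast, mul_assoc (j ^ w)]
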